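/- Fix integers k, m ≥ 1, a real λ with 1/2 < λ ≤ 1, and ε > 0. There exists n₀ such that for all n ≥ n₀ the following holds: if Σ = (a_1, …, a_n) is a sequence in ℤ^k with every entry in [0, M]^k such that e^m_Σ(A₁) ≠ e^m_Σ(A₂) for all distinct A₁, A₂ ∈ F_{λ,n} with |A₁|, |A₂| ≥ m, then M^{2m} ≥ (1 − ε) · ((m!)² · Γ(k/2 + 1)^{2/k} / ((2m²λ^{2m−1} + 2m²λ^{2m} + 1) · π · (k+2))) · |F_{λ,n}|^{2/k} / n^{2m−1}. -/

import Mathlib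

/-- `Fam n l` is the family `F_{λ,n}` of all subsets of `{1,…,n}` of size at most `λ·n`. -/
noncomputable def Fam (n : ℕ) (l : ℝ) : Finset (Finset (Fin n)) :=
  Finset.univ.filter (fun A => (A.card : ℝ) ≤ l * n)

/-- The `m`-th evaluation of the sequence `a` in `ℤ^k` on the subset `A`
(componentwise products); it is `0` when `|A| < m`. -/
def mthEvalVec (n k m : ℕ) (a : Fin n → Fin k → ℤ) (A : Finset (Fin n)) : Fin k → ℤ :=
  fun j => ∑ S ∈ A.powersetCard m, ∏ i ∈ S, a i j

/-- volume -/
lemma vol_ball (k : ℕ) (hk : 1 ≤ k) (c : Fin k → ℝ) (r : ℝ) (hr : 0 < r) :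
    MeasureTheory.volume {y : Fin k → ℝ | ∑ j, (y j - c j) ^ 2 < r ^ 2} =
      ENNReal.ofReal (r ^ k * (√Real.pi ^ k / Real.Gamma ((k : ℝ) / 2 + 1))) := by
  have : Nonempty (Fin k) := ⟨⟨0, hk⟩⟩
  have h := EuclideanSpace.volume_ball (Fin k) (WithLp.toLp 2 c) r
  rw [← (PiLp.volume_preserving_toLp (Fin k)).measure_preimage
    Metric.isOpen_ball.measurableSet.nullMeasurableSet] at h
  rw [ENNReal.ofReal_mul (by positivity), ENNReal.ofReal_pow hr.le]
  simp only [Fintype.card_fin] at h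
  rw [← h]
  congr 1
  ext y
  simp only [Set.mem_ofPred_eq, Set.mem_preimage, Metric.mem_ball, EuclideanSpace.dist_eq]
  rw [Real.sqrt_lt' ]
  · simp [Real.dist_eq, sq_abs]
  · exact hr

lemma count_ball (k : ℕ) (hk : 1 ≤ k) (c : Fin k → ℝ) (r : ℝ) (hr : 0 ≤ r)
    (P : Finset (Fin k → ℤ)) (hP : ∀ x ∈ P, ∑ j, ((x j : ℝ) - c j) ^ 2 < r ^ 2) :
    (P.card : ℝ) ≤ (r + √k) ^ k * (√Real.pi ^ k / Real.Gamma ((k : ℝ) / 2 + 1)) := by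
  have hG : 0 < Real.Gamma ((k : ℝ) / 2 + 1) := Real.Gamma_pos_of_pos (by positivity)
  have hd : Set.PairwiseDisjoint (P : Set (Fin k → ℤ))
      (fun x => Set.pi Set.univ (fun j => Set.Ico (x j : ℝ) ((x j : ℝ) + 1))) := by
    intro x _ y _ hxy
    refine Set.disjoint_left.2 fun z hzx hzy => hxy ?_
    funext j
    have h1 := hzx j trivial
    have h2 := hzy j trivial
    rw [← Int.floor_eq_iff.2 h1, ← Int.floor_eq_iff.2 h2]
  have hm := MeasureTheory.measure_biUnion_finset (μ := MeasureTheory.volume) hd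
    (fun x _ => MeasurableSet.univ_pi fun j => measurableSet_Ico)
  have h1 : ∀ x : Fin k → ℤ, MeasureTheory.volume
      (Set.pi Set.univ (fun j => Set.Ico (x j : ℝ) ((x j : ℝ) + 1))) = 1 := by
    intro x
    rw [Real.volume_pi_Ico]; simp
  simp only [h1] at hm
  have hsub : (⋃ x ∈ P, Set.pi Set.univ (fun j => Set.Ico (x j : ℝ) ((x j : ℝ) + 1))) ⊆
      {y : Fin k → ℝ | ∑ j, (y j - c j) ^ 2 < (r + √k) ^ 2} := by
    intro y hy
    simp only [Set.mem_iUnion] at hy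
    obtain ⟨x, hx, hy⟩ := hy
    have hb := hP x hx
    simp only [Set.mem_ofPred_eq]
    have hcs := Finset.sum_mul_sq_le_sq_mul_sq Finset.univ (fun j => (x j : ℝ) - c j)
      (fun j => y j - x j)
    have hk2 : ∑ j, (y j - x j) ^ 2 ≤ (k : ℝ) := by
      calc ∑ j, (y j - x j) ^ 2 ≤ ∑ j : Fin k, (1 : ℝ) := by
            refine Finset.sum_le_sum fun j _ => ?_
            have := hy j trivial
            have h1 := this.1
            have h2 := this.2
            nlinarith
        _ = k := by simp
    have he : ∑ j, (y j - c j) ^ 2 = ∑ j, ((x j : ℝ) - c j) ^ 2 + ∑ j, (y j - x j) ^ 2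
        + 2 * ∑ j, ((x j : ℝ) - c j) * (y j - x j) := by
      rw [Finset.mul_sum, ← Finset.sum_add_distrib, ← Finset.sum_add_distrib]
      exact Finset.sum_congr rfl fun j _ => by ring
    have hs : √(k:ℝ) ^ 2 = k := Real.sq_sqrt (by positivity)
    have hin : ∑ j, ((x j : ℝ) - c j) * (y j - x j) ≤ r * √k := by
      apply le_of_sq_le_sq _ (by positivity)
      rw [mul_pow, hs]
      refine hcs.trans ?_
      have : 0 ≤ ∑ j, (y j - x j) ^ 2 := Finset.sum_nonneg fun j _ => sq_nonneg _
      exact mul_le_mul hb.le hk2 this (sq_nonneg _)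
    rw [he]; nlinarith
  have hpos : 0 < r + √k := by
    have : (0:ℝ) < √k := Real.sqrt_pos.2 (by exact_mod_cast hk)
    positivity
  have := MeasureTheory.measure_mono (μ := MeasureTheory.volume) hsub
  rw [hm, vol_ball k hk c _ hpos] at this
  simp only [Finset.sum_const, nsmul_eq_mul, mul_one] at this
  rw [← ENNReal.ofReal_natCast] at this
  rwa [ENNReal.ofReal_le_ofReal_iff (by positivity)] at this

/-- second moment lower bound -/
lemma moment_lower (k : ℕ) (hk : 1 ≤ k) (c : Fin k → ℝ) (R : ℝ) (P : Finset (Fin k → ℤ))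
    (hR : 40 * √k ≤ R)
    (hN : (P.card : ℝ) = R ^ k * (√Real.pi ^ k / Real.Gamma ((k : ℝ) / 2 + 1))) :
    (k : ℝ) / (k + 2) * P.card * (0.4 * R ^ 2) ≤ ∑ x ∈ P, ∑ j, ((x j : ℝ) - c j) ^ 2 := by
  have hs : 0 ≤ √(k : ℝ) := Real.sqrt_nonneg _
  set r := 2 / 3 * R - √k with hr
  have hr0 : 0 ≤ r := by rw [hr]; linarith
  have hr2 : 0.4 * R ^ 2 ≤ r ^ 2 := by
    have h1 : 0.64 * R ≤ r := by rw [hr]; linarith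
    have : 0 ≤ R := by linarith
    nlinarith
  have hc := count_ball k hk c r hr0 (P.filter fun x => ∑ j, ((x j : ℝ) - c j) ^ 2 < r ^ 2)
    (fun x hx => (Finset.mem_filter.1 hx).2)
  rw [show r + √k = 2 / 3 * R by rw [hr]; ring, mul_pow, mul_assoc, ← hN] at hc
  have hb : (2 / 3 : ℝ) ^ k ≤ 2 / (k + 2) := by
    have h := one_add_mul_le_pow (a := (1/2 : ℝ)) (by norm_num) k
    rw [show (2 / 3 : ℝ) = (1 + 1 / 2)⁻¹ by norm_num, inv_pow,
      show (2 / ((k : ℝ) + 2)) = (1 + (k : ℝ) * (1/2))⁻¹ by field_simp; ring]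
    exact inv_anti₀ (by positivity) h
  have hsplit := Finset.card_filter_add_card_filter_not (s := P)
    (fun x => ∑ j, ((x j : ℝ) - c j) ^ 2 < r ^ 2)
  have hsplit' : ((P.filter fun x => ∑ j, ((x j : ℝ) - c j) ^ 2 < r ^ 2).card : ℝ) +
    ((P.filter fun x => ¬ ∑ j, ((x j : ℝ) - c j) ^ 2 < r ^ 2).card : ℝ) = P.card := by
    exact_mod_cast hsplit
  have hbig : (k : ℝ) / (k + 2) * P.card ≤
    ((P.filter fun x => ¬ ∑ j, ((x j : ℝ) - c j) ^ 2 < r ^ 2).card : ℝ) := by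
    have h2 : (2 / 3 : ℝ) ^ k * P.card ≤ 2 / (k + 2) * P.card := by gcongr
    have h3 : (k : ℝ) / (k + 2) * P.card = P.card - 2 / (k + 2) * P.card := by
      field_simp; ring
    linarith
  calc (k : ℝ) / (k + 2) * P.card * (0.4 * R ^ 2)
      ≤ ((P.filter fun x => ¬ ∑ j, ((x j : ℝ) - c j) ^ 2 < r ^ 2).card : ℝ) * r ^ 2 := by
        gcongr
    _ = ∑ x ∈ P.filter (fun x => ¬ ∑ j, ((x j : ℝ) - c j) ^ 2 < r ^ 2), r ^ 2 := by simp
    _ ≤ ∑ x ∈ P.filter (fun x => ¬ ∑ j, ((x j : ℝ) - c j) ^ 2 < r ^ 2),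
          ∑ j, ((x j : ℝ) - c j) ^ 2 :=
        Finset.sum_le_sum fun x hx => not_lt.1 (Finset.mem_filter.1 hx).2
    _ ≤ _ := Finset.sum_le_sum_of_subset_of_nonneg (Finset.filter_subset _ _)
        fun x _ _ => Finset.sum_nonneg fun j _ => sq_nonneg _

lemma card_super (n : ℕ) (S : Finset (Fin n)) :
    (∑ A : Finset (Fin n), (if S ⊆ A then (1:ℝ) else 0)) = 2 ^ n / 2 ^ S.card := by
  rw [Finset.sum_boole]
  have h : (Finset.univ.filter fun A : Finset (Fin n) => S ⊆ A) = Finset.Icc S Finset.univ := by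
    ext A; simp
  rw [h, Finset.card_Icc_finset (Finset.subset_univ _)]
  have hS : S.card ≤ n := by simpa using S.card_le_univ
  rw [eq_div_iff (by positivity)]
  push_cast
  rw [← pow_add]; congr 1; simp; omega

lemma cov (n m : ℕ) (S T : Finset (Fin n)) (hS : S.card = m) (hT : T.card = m) :
    ∑ A : Finset (Fin n), ((if S ⊆ A then (1:ℝ) else 0) - 1 / 2 ^ m) *
      ((if T ⊆ A then (1:ℝ) else 0) - 1 / 2 ^ m) = 2 ^ n / 4 ^ m * (2 ^ (S ∩ T).card - 1) := by
  have h : ∀ A : Finset (Fin n), ((if S ⊆ A then (1:ℝ) else 0) - 1 / 2 ^ m) *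
      ((if T ⊆ A then (1:ℝ) else 0) - 1 / 2 ^ m) = (if S ∪ T ⊆ A then (1:ℝ) else 0)
      - 1 / 2 ^ m * (if S ⊆ A then (1:ℝ) else 0) - 1 / 2 ^ m * (if T ⊆ A then (1:ℝ) else 0)
      + 1 / 4 ^ m := by
    intro A
    have h4 : (1 : ℝ) / 4 ^ m = 1 / 2 ^ m * (1 / 2 ^ m) := by
      rw [show (4 : ℝ) = 2 * 2 by norm_num, mul_pow]; field_simp
    rw [h4]
    simp only [Finset.union_subset_iff]
    by_cases h1 : S ⊆ A <;> by_cases h2 : T ⊆ A <;> simp [h1, h2] <;> ring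
  simp only [h]
  rw [Finset.sum_add_distrib, Finset.sum_sub_distrib, Finset.sum_sub_distrib, ← Finset.mul_sum,
    ← Finset.mul_sum, card_super, card_super, card_super, hS, hT]
  have hu := Finset.card_union_add_card_inter S T
  have hU : (2 : ℝ) ^ n / 2 ^ (S ∪ T).card = 2 ^ n / 4 ^ m * 2 ^ (S ∩ T).card := by
    rw [show (4 : ℝ) = 2 ^ 2 by norm_num, ← pow_mul, show 2 * m = (S ∪ T).card + (S ∩ T).card by omega,
      pow_add]
    field_simp
  rw [hU]
  have h4 : (4 : ℝ) ^ m = 2 ^ m * 2 ^ m := by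
    rw [show (4 : ℝ) = 2 * 2 by norm_num, mul_pow]
  simp only [Finset.sum_const, Finset.card_univ, Fintype.card_finset, Fintype.card_fin, nsmul_eq_mul]
  push_cast
  rw [h4]
  field_simp
  ring

lemma var_le (n m : ℕ) (b : Fin n → ℝ) (M : ℝ) (hb : ∀ i, 0 ≤ b i ∧ b i ≤ M) :
    ∑ A : Finset (Fin n), ((∑ S ∈ A.powersetCard m, ∏ i ∈ S, b i) -
      ∑ S ∈ (Finset.univ : Finset (Fin n)).powersetCard m, 1 / 2 ^ m * ∏ i ∈ S, b i) ^ 2 ≤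
    M ^ (2 * m) * (2 ^ n / 4 ^ m) * ∑ S ∈ (Finset.univ : Finset (Fin n)).powersetCard m,
      ∑ T ∈ (Finset.univ : Finset (Fin n)).powersetCard m, ((2:ℝ) ^ (S ∩ T).card - 1) := by
  set Q := (Finset.univ : Finset (Fin n)).powersetCard m with hQ
  have h1 : ∀ A : Finset (Fin n), (∑ S ∈ A.powersetCard m, ∏ i ∈ S, b i) -
      ∑ S ∈ Q, 1 / 2 ^ m * ∏ i ∈ S, b i =
      ∑ S ∈ Q, ((if S ⊆ A then (1:ℝ) else 0) - 1 / 2 ^ m) * ∏ i ∈ S, b i := by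
    intro A
    have : A.powersetCard m = Q.filter (fun S => S ⊆ A) := by
      ext S; simp [hQ, Finset.mem_powersetCard, and_comm]
    rw [this, Finset.sum_filter, ← Finset.sum_sub_distrib]
    refine Finset.sum_congr rfl fun S _ => ?_
    split_ifs <;> ring
  simp only [h1, sq, Finset.sum_mul_sum]
  rw [Finset.sum_comm, Finset.mul_sum]
  refine Finset.sum_le_sum fun S hS => ?_
  rw [Finset.sum_comm, Finset.mul_sum]
  refine Finset.sum_le_sum fun T hT => ?_
  have hS' := (Finset.mem_powersetCard.1 hS).2
  have hT' := (Finset.mem_powersetCard.1 hT).2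
  have hw : ∀ S : Finset (Fin n), S.card = m → 0 ≤ ∏ i ∈ S, b i ∧ ∏ i ∈ S, b i ≤ M ^ m := by
    intro S hS
    refine ⟨Finset.prod_nonneg fun i _ => (hb i).1, ?_⟩
    rw [← hS, ← Finset.prod_const]
    exact Finset.prod_le_prod (fun i _ => (hb i).1) (fun i _ => (hb i).2)
  calc _ = ((∏ i ∈ S, b i) * (∏ i ∈ T, b i)) * ∑ A : Finset (Fin n), ((if S ⊆ A then (1:ℝ) else 0) - 1 / 2 ^ m) *
      ((if T ⊆ A then (1:ℝ) else 0) - 1 / 2 ^ m) := by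
        rw [Finset.mul_sum]
        exact Finset.sum_congr rfl fun A _ => by ring
    _ = ((∏ i ∈ S, b i) * (∏ i ∈ T, b i)) * (2 ^ n / 4 ^ m * (2 ^ (S ∩ T).card - 1)) := by
        rw [cov n m S T hS' hT']
    _ ≤ (M ^ m * M ^ m) * (2 ^ n / 4 ^ m * (2 ^ (S ∩ T).card - 1)) := by
        have h2 : (0:ℝ) ≤ 2 ^ (S ∩ T).card - 1 := by
          have := one_le_pow₀ (M₀ := ℝ) (a := 2) (by norm_num) (n := (S ∩ T).card)
          linarith
        have ha := hw S hS'
        have hc := hw T hT'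
        apply mul_le_mul_of_nonneg_right _ (by positivity)
        exact mul_le_mul ha.2 hc.2 hc.1 (ha.1.trans ha.2)
    _ = _ := by rw [two_mul, pow_add]; ring

lemma card1 (n m : ℕ) (hm : 1 ≤ m) (i : Fin n) :
    ((((Finset.univ : Finset (Fin n)).powersetCard m).filter (fun S => i ∈ S)).card : ℝ) ≤
      n ^ (m - 1) / (m - 1).factorial := by
  have : (((Finset.univ : Finset (Fin n)).powersetCard m).filter (fun S => i ∈ S)).card ≤
      ((Finset.univ : Finset (Fin n)).powersetCard (m - 1)).card := by
    refine Finset.card_le_card_of_injOn (fun S => S.erase i) ?_ ?_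
    · intro S hS
      simp only [Finset.coe_filter, Finset.mem_powersetCard, Set.mem_ofPred_eq] at hS
      simp [Finset.mem_powersetCard, Finset.card_erase_of_mem hS.2, hS.1.2]
    · intro S hS T hT h
      simp only [Finset.coe_filter, Finset.mem_powersetCard, Set.mem_ofPred_eq] at hS hT
      rw [← Finset.insert_erase hS.2, ← Finset.insert_erase hT.2]
      simp only at h
      rw [h]
  rw [Finset.card_powersetCard, Finset.card_univ, Fintype.card_fin] at this
  exact (Nat.cast_le.2 this).trans (Nat.choose_le_pow_div _ _)

lemma card2 (n m : ℕ) (hm : 1 ≤ m) (i j : Fin n) (hij : i ≠ j) :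
    ((n : ℝ) * (((Finset.univ : Finset (Fin n)).powersetCard m).filter
      (fun S => i ∈ S ∧ j ∈ S)).card) ≤ n ^ (m - 1) := by
  have : (((Finset.univ : Finset (Fin n)).powersetCard m).filter (fun S => i ∈ S ∧ j ∈ S)).card ≤
      ((Finset.univ : Finset (Fin n)).powersetCard (m - 2)).card := by
    refine Finset.card_le_card_of_injOn (fun S => (S.erase i).erase j) ?_ ?_
    · intro S hS
      simp only [Finset.coe_filter, Finset.mem_powersetCard, Set.mem_ofPred_eq] at hS
      have hj : j ∈ S.erase i := Finset.mem_erase.2 ⟨hij.symm, hS.2.2⟩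
      simp [Finset.mem_powersetCard, Finset.card_erase_of_mem hj,
        Finset.card_erase_of_mem hS.2.1, hS.1.2]
      omega
    · intro S hS T hT h
      simp only [Finset.coe_filter, Finset.mem_powersetCard, Set.mem_ofPred_eq] at hS hT
      have hj : j ∈ S.erase i := Finset.mem_erase.2 ⟨hij.symm, hS.2.2⟩
      have hj' : j ∈ T.erase i := Finset.mem_erase.2 ⟨hij.symm, hT.2.2⟩
      rw [← Finset.insert_erase hS.2.1, ← Finset.insert_erase hT.2.1,
        ← Finset.insert_erase hj, ← Finset.insert_erase hj']
      simp only at h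
      rw [h]
  rw [Finset.card_powersetCard, Finset.card_univ, Fintype.card_fin] at this
  rcases Nat.lt_or_ge m 2 with h2 | h2
  · have : (((Finset.univ : Finset (Fin n)).powersetCard m).filter (fun S => i ∈ S ∧ j ∈ S)) = ∅ := by
      refine Finset.filter_eq_empty_iff.2 fun S hS hc => ?_
      have h3 := (Finset.mem_powersetCard.1 hS).2
      have : 1 < S.card := Finset.one_lt_card.2 ⟨i, hc.1, j, hc.2, hij⟩
      omega
    rw [this]; simp
  · have h3 := this.trans (Nat.choose_le_pow n (m - 2))
    have h4 := Nat.mul_le_mul_left n h3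
    rw [← pow_succ', show m - 2 + 1 = m - 1 by omega] at h4
    exact_mod_cast h4

lemma inter_sum (n m : ℕ) (hm : 1 ≤ m) (hn : 1 ≤ n) :
    ∑ S ∈ (Finset.univ : Finset (Fin n)).powersetCard m,
      ∑ T ∈ (Finset.univ : Finset (Fin n)).powersetCard m, ((2:ℝ) ^ (S ∩ T).card - 1) ≤
    n * (n ^ (m - 1) / (m - 1).factorial) ^ 2 + 2 ^ m * (n ^ (m - 1)) ^ 2 := by
  set Q := (Finset.univ : Finset (Fin n)).powersetCard m with hQ
  have hpt : ∀ S ∈ Q, ∀ T ∈ Q, (2:ℝ) ^ (S ∩ T).card - 1 ≤ (S ∩ T).card +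
      2 ^ m * ((S ∩ T).offDiag.card) := by
    intro S hS T hT
    have h1 : (S ∩ T).card ≤ m := by
      rw [← (Finset.mem_powersetCard.1 hS).2]; exact Finset.card_le_card Finset.inter_subset_left
    rw [Finset.offDiag_card]
    generalize (S ∩ T).card = t at *
    rcases t with _ | _ | t
    · simp
    · simp; norm_num
    · have h2 : (2:ℝ) ^ (t+2) ≤ 2 ^ m := pow_le_pow_right₀ (by norm_num) h1
      have h3 : (1:ℝ) ≤ ((((t+2) * (t+2) - (t+2) : ℕ)) : ℝ) := by
        norm_cast
        have : (t+2)*(t+2) = (t+2) + (t+2) + t*(t+2) := by ring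
        omega
      have h4 : (0:ℝ) ≤ 2 ^ m := by positivity
      have h5 := mul_le_mul_of_nonneg_left h3 h4
      have h6 : (0:ℝ) ≤ ((t + 1 + 1 : ℕ) : ℝ) := by positivity
      linarith
  have hA : ∑ S ∈ Q, ∑ T ∈ Q, ((S ∩ T).card : ℝ) ≤ n * (n ^ (m - 1) / (m - 1).factorial) ^ 2 := by
    have : ∀ S T : Finset (Fin n), ((S ∩ T).card : ℝ) =
        ∑ i, (if i ∈ S then (1:ℝ) else 0) * (if i ∈ T then (1:ℝ) else 0) := by
      intro S T
      have : S ∩ T = Finset.univ.filter (fun i => i ∈ S ∧ i ∈ T) := by ext; simp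
      rw [this, ← Finset.sum_boole]
      exact Finset.sum_congr rfl fun i _ => by
        by_cases h1 : i ∈ S <;> by_cases h2 : i ∈ T <;> simp [h1, h2]
    calc ∑ S ∈ Q, ∑ T ∈ Q, ((S ∩ T).card : ℝ)
        = ∑ i : Fin n, ((Q.filter (fun S => i ∈ S)).card : ℝ) ^ 2 := by
          simp only [this]
          rw [Finset.sum_congr rfl (fun S _ => Finset.sum_comm), Finset.sum_comm]
          refine Finset.sum_congr rfl fun i _ => ?_
          rw [← Finset.sum_boole, sq, Finset.sum_mul_sum]
      _ ≤ ∑ i : Fin n, ((n:ℝ) ^ (m - 1) / (m - 1).factorial) ^ 2 := by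
          refine Finset.sum_le_sum fun i _ => ?_
          gcongr
          exact card1 n m hm i
      _ = _ := by simp
  have hB : ∑ S ∈ Q, ∑ T ∈ Q, ((S ∩ T).offDiag.card : ℝ) ≤ (n ^ (m - 1)) ^ 2 := by
    have : ∀ S T : Finset (Fin n), ((S ∩ T).offDiag.card : ℝ) =
        ∑ p ∈ (Finset.univ : Finset (Fin n)).offDiag, (if p.1 ∈ S ∧ p.2 ∈ S then (1:ℝ) else 0) *
          (if p.1 ∈ T ∧ p.2 ∈ T then (1:ℝ) else 0) := by
      intro S T
      have : (S ∩ T).offDiag = (Finset.univ : Finset (Fin n)).offDiag.filter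
          (fun p => (p.1 ∈ S ∧ p.2 ∈ S) ∧ (p.1 ∈ T ∧ p.2 ∈ T)) := by
        ext p; simp only [Finset.mem_offDiag, Finset.mem_inter, Finset.mem_filter,
          Finset.mem_univ, true_and]; tauto
      rw [this, ← Finset.sum_boole]
      refine Finset.sum_congr rfl fun p _ => ?_
      rw [ite_and]
      split_ifs <;> simp
    have hn0 : (0:ℝ) < n := by exact_mod_cast hn
    calc ∑ S ∈ Q, ∑ T ∈ Q, ((S ∩ T).offDiag.card : ℝ)
        = ∑ p ∈ (Finset.univ : Finset (Fin n)).offDiag,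
            ((Q.filter (fun S => p.1 ∈ S ∧ p.2 ∈ S)).card : ℝ) ^ 2 := by
          simp only [this]
          rw [Finset.sum_congr rfl (fun S _ => Finset.sum_comm), Finset.sum_comm]
          refine Finset.sum_congr rfl fun i _ => ?_
          rw [← Finset.sum_boole, sq, Finset.sum_mul_sum]
      _ ≤ ∑ p ∈ (Finset.univ : Finset (Fin n)).offDiag, ((n:ℝ) ^ (m - 1) / n) ^ 2 := by
          refine Finset.sum_le_sum fun p hp => ?_
          gcongr
          rw [le_div_iff₀' hn0]
          exact card2 n m hm p.1 p.2 (Finset.mem_offDiag.1 hp).2.2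
      _ ≤ (n * n) * ((n:ℝ) ^ (m - 1) / n) ^ 2 := by
          rw [Finset.sum_const, nsmul_eq_mul]
          gcongr
          rw [Finset.offDiag_card]
          simp only [Finset.card_univ, Fintype.card_fin]
          exact_mod_cast Nat.sub_le _ _
      _ = _ := by field_simp
  calc _ ≤ ∑ S ∈ Q, ∑ T ∈ Q, (((S ∩ T).card : ℝ) + 2 ^ m * ((S ∩ T).offDiag.card)) :=
        Finset.sum_le_sum fun S hS => Finset.sum_le_sum fun T hT => hpt S hS T hT
    _ = ∑ S ∈ Q, ∑ T ∈ Q, ((S ∩ T).card : ℝ) +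
        2 ^ m * ∑ S ∈ Q, ∑ T ∈ Q, ((S ∩ T).offDiag.card : ℝ) := by
        simp only [Finset.sum_add_distrib, Finset.mul_sum]
    _ ≤ _ := by gcongr

lemma fam_half (n : ℕ) (l : ℝ) (hl0 : 1 / 2 < l) : (2:ℝ) ^ n ≤ 2 * (Fam n l).card := by
  have h1 : (Finset.univ.filter (fun A : Finset (Fin n) => ¬ ((A.card : ℝ) ≤ l * n))).card ≤
      (Fam n l).card := by
    refine Finset.card_le_card_of_injOn (fun A => Aᶜ) ?_ (fun A _ B _ h => compl_injective h)
    intro A hA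
    have hA' : ¬ ((A.card : ℝ) ≤ l * n) := by simpa using hA
    have hc : ((Aᶜ).card : ℝ) + A.card = n := by
      have := Finset.card_compl_add_card A
      rw [Fintype.card_fin] at this
      exact_mod_cast this
    have hn : (0:ℝ) ≤ n := by positivity
    have : ((Aᶜ).card : ℝ) ≤ l * n := by nlinarith
    simpa [Fam] using this
  have h2 := Finset.card_filter_add_card_filter_not (s := (Finset.univ : Finset (Finset (Fin n))))
    (fun A : Finset (Fin n) => ((A.card : ℝ) ≤ l * n))
  rw [Finset.card_univ, Fintype.card_finset, Fintype.card_fin] at h2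
  have h3 : 2 ^ n ≤ 2 * (Fam n l).card := by
    change (Fam n l).card + _ = _ at h2
    omega
  exact_mod_cast h3

lemma small_card (n m : ℕ) (hn : 1 ≤ n) :
    ((Finset.univ.filter (fun A : Finset (Fin n) => A.card < m)).card : ℝ) ≤ m * n ^ m := by
  have h : (Finset.univ.filter (fun A : Finset (Fin n) => A.card < m)) ⊆
      (Finset.range m).biUnion (fun i => (Finset.univ : Finset (Fin n)).powersetCard i) := by
    intro A hA
    simpa [Finset.mem_powersetCard] using hA
  have h2 := (Finset.card_le_card h).trans Finset.card_biUnion_le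
  have h3 : ∑ i ∈ Finset.range m, ((Finset.univ : Finset (Fin n)).powersetCard i).card ≤
      ∑ i ∈ Finset.range m, n ^ m := by
    refine Finset.sum_le_sum fun i hi => ?_
    rw [Finset.card_powersetCard, Finset.card_univ, Fintype.card_fin]
    exact (Nat.choose_le_pow n i).trans (Nat.pow_le_pow_right hn (Finset.mem_range.1 hi).le)
  have h4 := h2.trans h3
  simp only [Finset.sum_const, Finset.card_range, smul_eq_mul] at h4
  exact_mod_cast h4

lemma ev (k m : ℕ) : ∃ n₀ : ℕ, ∀ n : ℕ, n₀ ≤ n → 1 ≤ n ∧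
    (m : ℝ) * n ^ m ≤ 0.005 * 2 ^ n ∧
    (40 * √k) ^ k * (√Real.pi ^ k / Real.Gamma ((k : ℝ) / 2 + 1)) ≤ 0.495 * 2 ^ n ∧
    (m.factorial : ℝ) ^ 2 * 2 ^ m ≤ 0.01 * n := by
  have h1 := (tendsto_pow_const_div_const_pow_of_one_lt m (r := (2:ℝ)) (by norm_num)).const_mul (m:ℝ)
  rw [mul_zero] at h1
  have h1 := h1.eventually_le_const (u := (0.005:ℝ)) (by norm_num)
  have h2 := ((tendsto_pow_atTop_atTop_of_one_lt (r := (2:ℝ)) (by norm_num)).const_mul_atTop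
    (r := (0.495:ℝ)) (by norm_num)).eventually_ge_atTop
    ((40 * √k) ^ k * (√Real.pi ^ k / Real.Gamma ((k : ℝ) / 2 + 1)))
  have h3 := ((tendsto_natCast_atTop_atTop (R := ℝ)).const_mul_atTop
    (r := (0.01:ℝ)) (by norm_num)).eventually_ge_atTop ((m.factorial : ℝ) ^ 2 * 2 ^ m)
  obtain ⟨n₀, h⟩ := Filter.eventually_atTop.1 ((h1.and h2).and (h3.and (Filter.eventually_ge_atTop 1)))
  refine ⟨n₀, fun n hn => ?_⟩
  obtain ⟨⟨a, b⟩, c, d⟩ := h n hn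
  refine ⟨d, ?_, b, c⟩
  rwa [← mul_div_assoc, div_le_iff₀ (by positivity)] at a

lemma var_bound (n m : ℕ) (hm : 1 ≤ m) (hn : 1 ≤ n) (b : Fin n → ℝ) (M : ℝ)
    (hb : ∀ i, 0 ≤ b i ∧ b i ≤ M) (hbig : (m.factorial : ℝ) ^ 2 * 2 ^ m ≤ 0.01 * n) :
    ∑ A : Finset (Fin n), ((∑ S ∈ A.powersetCard m, ∏ i ∈ S, b i) -
      ∑ S ∈ (Finset.univ : Finset (Fin n)).powersetCard m, 1 / 2 ^ m * ∏ i ∈ S, b i) ^ 2 ≤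
    2 ^ n * (M ^ (2 * m) * n ^ (2 * m - 1) / (m.factorial : ℝ) ^ 2 * (m ^ 2 / 4 ^ m + 0.01)) := by
  refine (var_le n m b M hb).trans ?_
  have hM : 0 ≤ M ^ (2 * m) := by rw [pow_mul']; positivity
  have hp : (n:ℝ) ^ (2 * m - 1) = n * (n ^ (m - 1)) ^ 2 := by
    rw [← pow_mul, ← pow_succ']; congr 1; omega
  have hf : (m.factorial : ℝ) = m * (m - 1).factorial := by
    exact_mod_cast (Nat.mul_factorial_pred (by omega)).symm
  have hf0 : (0:ℝ) < (m-1).factorial := by positivity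
  have hm0 : (0:ℝ) < m := by exact_mod_cast hm
  have h4 : (1:ℝ) ≤ 4 ^ m := one_le_pow₀ (by norm_num)
  have key : (1:ℝ) / 4 ^ m * (n * (n ^ (m - 1) / (m - 1).factorial) ^ 2 + 2 ^ m * (n ^ (m - 1)) ^ 2) ≤
      n ^ (2 * m - 1) / (m.factorial : ℝ) ^ 2 * (m ^ 2 / 4 ^ m + 0.01) := by
    have e1 : (1:ℝ) / 4 ^ m * (n * (n ^ (m - 1) / (m - 1).factorial) ^ 2) =
        n ^ (2 * m - 1) / (m.factorial : ℝ) ^ 2 * (m ^ 2 / 4 ^ m) := by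
      rw [hp, hf]; field_simp
    have e2 : (1:ℝ) / 4 ^ m * (2 ^ m * (n ^ (m - 1)) ^ 2) ≤
        n ^ (2 * m - 1) / (m.factorial : ℝ) ^ 2 * 0.01 := by
      calc (1:ℝ) / 4 ^ m * (2 ^ m * (n ^ (m - 1)) ^ 2) ≤ 1 * (2 ^ m * (n ^ (m - 1)) ^ 2) := by
            gcongr
            rw [div_le_one (by positivity)]; exact h4
        _ = (m.factorial : ℝ) ^ 2 * 2 ^ m * ((n ^ (m - 1)) ^ 2 / (m.factorial : ℝ) ^ 2) := by
            field_simp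
        _ ≤ 0.01 * n * ((n ^ (m - 1)) ^ 2 / (m.factorial : ℝ) ^ 2) := by gcongr
        _ = _ := by rw [hp]; ring
    rw [mul_add, mul_add, e1]; linarith
  calc _ ≤ M ^ (2 * m) * (2 ^ n / 4 ^ m) *
        (n * (n ^ (m - 1) / (m - 1).factorial) ^ 2 + 2 ^ m * (n ^ (m - 1)) ^ 2) := by
        gcongr; exact inter_sum n m hm hn
    _ = 2 ^ n * M ^ (2 * m) * ((1:ℝ) / 4 ^ m *
        (n * (n ^ (m - 1) / (m - 1).factorial) ^ 2 + 2 ^ m * (n ^ (m - 1)) ^ 2)) := by ring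
    _ ≤ 2 ^ n * M ^ (2 * m) * (n ^ (2 * m - 1) / (m.factorial : ℝ) ^ 2 * (m ^ 2 / 4 ^ m + 0.01)) := by
        gcongr
    _ = _ := by ring

theorem stmt11 (k m : ℕ) (hk : 1 ≤ k) (hm : 1 ≤ m) (l : ℝ) (hl0 : 1 / 2 < l) (hl : l ≤ 1)
    (ε : ℝ) (hε : 0 < ε) :
    ∃ n₀ : ℕ, ∀ n : ℕ, n₀ ≤ n → ∀ M : ℤ, ∀ a : Fin n → Fin k → ℤ,
      (∀ i j, 0 ≤ a i j ∧ a i j ≤ M) →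
      (∀ A₁ A₂ : Finset (Fin n), A₁ ∈ Fam n l → A₂ ∈ Fam n l → A₁ ≠ A₂ →
        m ≤ A₁.card → m ≤ A₂.card → mthEvalVec n k m a A₁ ≠ mthEvalVec n k m a A₂) →
      (M : ℝ) ^ (2 * m) ≥ (1 - ε) *
        ((m.factorial : ℝ) ^ 2 * Real.Gamma ((k : ℝ) / 2 + 1) ^ ((2 : ℝ) / k) /
          ((2 * (m : ℝ) ^ 2 * l ^ (2 * m - 1) + 2 * (m : ℝ) ^ 2 * l ^ (2 * m) + 1) *
            Real.pi * ((k : ℝ) + 2))) *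
        (((Fam n l).card : ℝ)) ^ ((2 : ℝ) / k) / (n : ℝ) ^ (2 * m - 1) := by
  obtain ⟨n₀, hn₀⟩ := ev k m
  refine ⟨n₀, fun n hn M a ha hinj => ?_⟩
  obtain ⟨hn1, hsm, hRbig, hfac⟩ := hn₀ n hn
  have hl' : 0 < l := by linarith
  have hkR : (1:ℝ) ≤ k := by exact_mod_cast hk
  have hnR : (1:ℝ) ≤ n := by exact_mod_cast hn1
  have hmR : (1:ℝ) ≤ m := by exact_mod_cast hm
  set g := Real.Gamma ((k : ℝ) / 2 + 1) with hg
  have hG : 0 < g := Real.Gamma_pos_of_pos (by positivity)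
  set D := 2 * (m : ℝ) ^ 2 * l ^ (2 * m - 1) + 2 * (m : ℝ) ^ 2 * l ^ (2 * m) + 1 with hD
  have hDlow : 6 * ((m:ℝ) ^ 2 / 4 ^ m) + 1 ≤ D := by
    have h1 : (1/2 : ℝ) ^ (2 * m) ≤ l ^ (2 * m) := by gcongr
    have h2 : (1/2 : ℝ) ^ (2 * m - 1) ≤ l ^ (2 * m - 1) := by gcongr
    have h3 : (1/2 : ℝ) ^ (2 * m) = 1 / 4 ^ m := by rw [pow_mul, one_div (4 ^ m : ℝ), ← inv_pow]; norm_num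
    have h4 : (1/2 : ℝ) ^ (2 * m - 1) = 2 * (1 / 4 ^ m) := by
      rw [← h3]; conv_rhs => rw [show 2 * m = (2 * m - 1) + 1 by omega, pow_succ]
      ring
    rw [h3] at h1; rw [h4] at h2
    have h5 : 2 * (m:ℝ)^2 * (2 * (1 / 4 ^ m)) ≤ 2 * (m:ℝ)^2 * l ^ (2 * m - 1) := by gcongr
    have h6 : 2 * (m:ℝ)^2 * (1 / 4 ^ m) ≤ 2 * (m:ℝ)^2 * l ^ (2 * m) := by gcongr
    rw [hD]
    have : 6 * ((m:ℝ) ^ 2 / 4 ^ m) = 2 * (m:ℝ)^2 * (2 * (1 / 4 ^ m)) + 2 * (m:ℝ)^2 * (1 / 4 ^ m) := by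
      ring
    linarith
  have hq : 0 < (m:ℝ) ^ 2 / 4 ^ m := by positivity
  have hD0 : 0 < D := by linarith
  -- the family
  set F := Fam n l with hF
  set W := F.filter (fun A => m ≤ A.card) with hW
  have hFhalf := fam_half n l hl0
  rw [← hF] at hFhalf
  have h2n : (0:ℝ) < 2 ^ n := by positivity
  have hWF : (F.card : ℝ) - 0.005 * 2 ^ n ≤ W.card := by
    have h1 := Finset.card_filter_add_card_filter_not (s := F) (fun A => m ≤ A.card)
    have h2 : (F.filter (fun A => ¬ m ≤ A.card)).card ≤
        (Finset.univ.filter (fun A : Finset (Fin n) => A.card < m)).card := by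
      refine Finset.card_le_card fun A hA => ?_
      simpa using (Finset.mem_filter.1 hA).2
    have h3 := small_card n m hn1
    have h2' : ((F.filter (fun A => ¬ m ≤ A.card)).card : ℝ) ≤
        (Finset.univ.filter (fun A : Finset (Fin n) => A.card < m)).card := by exact_mod_cast h2
    have h1' : (W.card : ℝ) + (F.filter (fun A => ¬ m ≤ A.card)).card = F.card := by
      exact_mod_cast h1
    linarith
  have hF0 : (0:ℝ) < F.card := by linarith
  have hN1 : 0.495 * 2 ^ n ≤ (W.card : ℝ) := by linarith
  have hN2 : 0.99 * F.card ≤ (W.card : ℝ) := by linarith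
  have hN0 : (0:ℝ) < W.card := by linarith
  -- the points
  set P := W.image (mthEvalVec n k m a) with hP
  have hWinj : Set.InjOn (mthEvalVec n k m a) W := by
    intro A hA B hB h
    by_contra hne
    have hA' := Finset.mem_filter.1 (Finset.mem_coe.1 hA)
    have hB' := Finset.mem_filter.1 (Finset.mem_coe.1 hB)
    exact hinj A B hA'.1 hB'.1 hne hA'.2 hB'.2 h
  have hPc : P.card = W.card := Finset.card_image_of_injOn hWinj
  -- radius
  set R := (g * W.card) ^ ((1:ℝ) / k) / √Real.pi with hR
  have hsp : 0 < √Real.pi := Real.sqrt_pos.2 Real.pi_pos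
  have hgN : 0 < g * (W.card : ℝ) := by positivity
  have hR0 : 0 ≤ R := by positivity
  have hRk : (W.card : ℝ) = R ^ k * (√Real.pi ^ k / g) := by
    rw [hR, div_pow, ← Real.rpow_natCast ((g * (W.card:ℝ)) ^ ((1:ℝ) / k)), ← Real.rpow_mul hgN.le,
      one_div_mul_cancel (by positivity), Real.rpow_one]
    field_simp
  have hR2 : R ^ 2 = (g * W.card) ^ ((2:ℝ) / k) / Real.pi := by
    rw [hR, div_pow, Real.sq_sqrt Real.pi_pos.le, ← Real.rpow_natCast _ 2, ← Real.rpow_mul hgN.le]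
    congr 2
    push_cast; ring
  have hRge : 40 * √k ≤ R := by
    have h1 := hRbig.trans hN1
    rw [hRk] at h1
    have h2 : (40 * √(k:ℝ)) ^ k ≤ R ^ k := le_of_mul_le_mul_right h1 (by positivity)
    exact le_of_pow_le_pow_left₀ (by omega) hR0 h2
  set c : Fin k → ℝ := fun j => ∑ S ∈ (Finset.univ : Finset (Fin n)).powersetCard m,
    1 / 2 ^ m * ∏ i ∈ S, (a i j : ℝ) with hc
  have hlow := moment_lower k hk c R P hRge (by rw [hPc]; exact hRk)
  set X := (M:ℝ) ^ (2 * m) * n ^ (2 * m - 1) / (m.factorial : ℝ) ^ 2 with hX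
  have hX0 : 0 ≤ X := by
    have : 0 ≤ (M:ℝ) ^ (2 * m) := by rw [pow_mul']; positivity
    positivity
  have hup : ∑ x ∈ P, ∑ j, ((x j : ℝ) - c j) ^ 2 ≤
      k * (2 ^ n * (X * (m ^ 2 / 4 ^ m + 0.01))) := by
    rw [hP, Finset.sum_image hWinj]
    calc ∑ A ∈ W, ∑ j, ((mthEvalVec n k m a A j : ℝ) - c j) ^ 2
        ≤ ∑ A : Finset (Fin n), ∑ j, ((mthEvalVec n k m a A j : ℝ) - c j) ^ 2 :=
          Finset.sum_le_sum_of_subset_of_nonneg (Finset.subset_univ _)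
            fun A _ _ => Finset.sum_nonneg fun j _ => sq_nonneg _
      _ = ∑ j, ∑ A : Finset (Fin n), ((mthEvalVec n k m a A j : ℝ) - c j) ^ 2 := Finset.sum_comm
      _ ≤ ∑ j : Fin k, 2 ^ n * (X * (m ^ 2 / 4 ^ m + 0.01)) := by
          refine Finset.sum_le_sum fun j _ => ?_
          have := var_bound n m hm hn1 (fun i => (a i j : ℝ)) M
            (fun i => ⟨by exact_mod_cast (ha i j).1, by exact_mod_cast (ha i j).2⟩) hfac
          simpa only [mthEvalVec, Int.cast_sum, Int.cast_prod] using this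
      _ = _ := by simp
  have hmain := hlow.trans hup
  rw [hPc] at hmain
  -- combine
  clear hlow hup hinj ha hn₀ hsm hRbig hfac hRge hRk
  clear_value c P R W F X D g
  clear hP hW hR hF hg hD hc hWinj hPc
  obtain ⟨Y, hY⟩ : ∃ Y : ℝ, Y = g ^ ((2:ℝ) / k) * (F.card : ℝ) ^ ((2:ℝ) / k) / Real.pi / (k + 2) := ⟨_, rfl⟩
  have hpi := Real.pi_pos
  have hY0 : 0 ≤ Y := by rw [hY]; positivity
  have hRY : 0.98 * Y * (k + 2) ≤ R ^ 2 := by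
    have h1 : (0.99 * (F.card:ℝ)) ^ ((2:ℝ)/k) ≤ (W.card : ℝ) ^ ((2:ℝ)/k) :=
      Real.rpow_le_rpow (by positivity) hN2 (by positivity)
    rw [Real.mul_rpow (by norm_num) hF0.le] at h1
    have h2 : (0.98:ℝ) ≤ 0.99 ^ ((2:ℝ)/k) := by
      calc (0.98:ℝ) ≤ 0.99 ^ (2:ℝ) := by norm_num
        _ ≤ _ := Real.rpow_le_rpow_of_exponent_ge (by norm_num) (by norm_num)
            (div_le_self (by norm_num) hkR)
    rw [hR2, Real.mul_rpow hG.le hN0.le]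
    have h3 : 0.98 * (F.card:ℝ) ^ ((2:ℝ)/k) ≤ (W.card : ℝ) ^ ((2:ℝ)/k) :=
      le_trans (by gcongr) h1
    calc 0.98 * Y * (k + 2) = g ^ ((2:ℝ) / k) * (0.98 * (F.card : ℝ) ^ ((2:ℝ) / k)) / Real.pi := by
          rw [hY]; field_simp
      _ ≤ _ := by gcongr
  have hXY : Y ≤ X * D := by
    have h1 : (k:ℝ) / (k + 2) * (0.495 * 2 ^ n) * (0.4 * (0.98 * Y * (k + 2))) ≤
        k * (2 ^ n * (X * (m ^ 2 / 4 ^ m + 0.01))) := le_trans (by gcongr) hmain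
    have h2 : (k:ℝ) / (k + 2) * (0.495 * 2 ^ n) * (0.4 * (0.98 * Y * (k + 2))) =
        (k * 2 ^ n) * (0.495 * 0.4 * 0.98 * Y) := by field_simp
    rw [h2, ← mul_assoc (k:ℝ)] at h1
    have h3 := le_of_mul_le_mul_left h1 (by positivity)
    have h4 : (m:ℝ) ^ 2 / 4 ^ m + 0.01 ≤ 0.495 * 0.4 * 0.98 * D := by linarith
    have h5 := mul_le_mul_of_nonneg_left h4 hX0
    linarith
  have hfin : (m.factorial : ℝ) ^ 2 * g ^ ((2 : ℝ) / k) / (D * Real.pi * ((k : ℝ) + 2)) *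
        (F.card : ℝ) ^ ((2 : ℝ) / k) / (n : ℝ) ^ (2 * m - 1) ≤ (M : ℝ) ^ (2 * m) := by
    have e1 : (m.factorial : ℝ) ^ 2 * g ^ ((2 : ℝ) / k) / (D * Real.pi * ((k : ℝ) + 2)) *
        (F.card : ℝ) ^ ((2 : ℝ) / k) / (n : ℝ) ^ (2 * m - 1) =
        Y * ((m.factorial : ℝ) ^ 2 / (n : ℝ) ^ (2 * m - 1) / D) := by
      rw [hY]; field_simp
    have e2 : (M : ℝ) ^ (2 * m) = X * D * ((m.factorial : ℝ) ^ 2 / (n : ℝ) ^ (2 * m - 1) / D) := by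
      rw [hX]; field_simp
    rw [e1, e2]
    gcongr
  refine ge_iff_le.2 (le_trans ?_ hfin)
  rw [mul_assoc, mul_div_assoc]
  refine mul_le_of_le_one_left ?_ (by linarith)
  positivity
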